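/- arXiv:cs/0701026 — 4 statements merged into one kernel-verified Lean document; each statement's English description precedes it below -/
import Mathlib

section
/- Let W be a real random variable with cumulative distribution function H satisfying |H(y) − Φ(y)| ≤ ε for all y ∈ ℝ, where ε ≥ 0. Then for every c > 0 and every b ∈ ℝ, E[e^{c(W−b)} · 1{W ≤ b}] ≤ ∫_{−∞}^{b} e^{c(y−b)} (1/√(2π)) e^{−y²/2} dy + 2ε. -/
open MeasureTheory ProbabilityTheory Real

/-- The standard normal (unit Gaussian) cumulative distribution function. -/
noncomputable def Phi (x : ℝ) : ℝ :=
  ∫ t in Set.Iic x, Real.exp (-t ^ 2 / 2) / Real.sqrt (2 * Real.pi)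

/-- Layer-cake representation of a truncated exponential moment in terms of the distribution
function. -/
theorem setIntegral_Iic_exp_eq_setIntegral_Ioc (μ : Measure ℝ) [IsFiniteMeasure μ]
    {c : ℝ} (hc : 0 < c) (b : ℝ) :
    ∫ x in Set.Iic b, Real.exp (c * (x - b)) ∂μ
      = ∫ t in Set.Ioc (0 : ℝ) 1,
          (μ.real (Set.Iic b) - μ.real (Set.Iic (b + Real.log t / c))) := by
  have hint : Integrable (fun x => Real.exp (c * (x - b))) (μ.restrict (Set.Iic b)) := by
    refine (integrable_const (1 : ℝ)).mono' (by fun_prop) ?_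
    refine (ae_restrict_iff' measurableSet_Iic).2 (ae_of_all _ fun x hx => ?_)
    rw [Real.norm_eq_abs, abs_of_pos (Real.exp_pos _), Real.exp_le_one_iff]
    exact mul_nonpos_of_nonneg_of_nonpos hc.le (sub_nonpos.2 hx)
  rw [hint.integral_eq_integral_meas_lt (ae_of_all _ fun x => (Real.exp_pos _).le)]
  have hmeas (t : ℝ) : MeasurableSet {x | t < Real.exp (c * (x - b))} :=
    measurableSet_lt measurable_const (by fun_prop)
  rw [setIntegral_eq_of_subset_of_forall_sdiff_eq_zero measurableSet_Ioi
    Set.Ioc_subset_Ioi_self]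
  · refine setIntegral_congr_fun measurableSet_Ioc fun t ht => ?_
    have hlog : Real.log t / c ≤ 0 :=
      div_nonpos_of_nonpos_of_nonneg (Real.log_nonpos ht.1.le ht.2) hc.le
    rw [measureReal_restrict_apply (hmeas t),
      ← measureReal_sdiff (Set.Iic_subset_Iic.2 (by linarith)) measurableSet_Iic]
    congr 1
    ext x
    simp only [Set.mem_inter_iff, Set.mem_ofPred_eq, Set.mem_Iic, Set.mem_sdiff, not_le,
      ← Real.log_lt_iff_lt_exp ht.1, ← lt_sub_iff_add_lt', div_lt_iff₀' hc]
    exact and_comm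
  · intro t ht
    have ht1 : 1 < t := by
      by_contra! h
      exact ht.2 ⟨ht.1, h⟩
    rw [measureReal_restrict_apply (hmeas t)]
    convert measureReal_empty
    refine Set.eq_empty_of_forall_notMem fun x hx => ?_
    have hexp : Real.exp (c * (x - b)) ≤ 1 :=
      Real.exp_le_one_iff.2 (mul_nonpos_of_nonneg_of_nonpos hc.le (sub_nonpos.2 hx.2))
    exact absurd (hx.1.trans_le hexp) ht1.not_gt

/-- Truncated exponential moments of two laws whose distribution functions are uniformly
`ε`-close differ by at most `2 * ε`. -/
theorem setIntegral_Iic_exp_le_add (μ ν : Measure ℝ) [IsFiniteMeasure μ] [IsFiniteMeasure ν]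
    {ε : ℝ} (h : ∀ y, |μ.real (Set.Iic y) - ν.real (Set.Iic y)| ≤ ε)
    {c : ℝ} (hc : 0 < c) (b : ℝ) :
    ∫ x in Set.Iic b, Real.exp (c * (x - b)) ∂μ
      ≤ (∫ x in Set.Iic b, Real.exp (c * (x - b)) ∂ν) + 2 * ε := by
  have hint (ρ : Measure ℝ) [IsFiniteMeasure ρ] : IntegrableOn
      (fun t => ρ.real (Set.Iic b) - ρ.real (Set.Iic (b + Real.log t / c)))
      (Set.Ioc (0 : ℝ) 1) := by
    refine (integrable_const (ρ.real Set.univ)).mono' ?_ (ae_of_all _ fun t => ?_)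
    · have hmono : Monotone fun y => ρ.real (Set.Iic y) := fun x y hxy =>
        measureReal_mono (Set.Iic_subset_Iic.2 hxy)
      exact (measurable_const.sub (hmono.measurable.comp (by fun_prop))).aestronglyMeasurable
    · rw [Real.norm_eq_abs]
      exact abs_sub_le_of_nonneg_of_le measureReal_nonneg (measureReal_mono (Set.subset_univ _))
        measureReal_nonneg (measureReal_mono (Set.subset_univ _))
  have hconst : ∫ _ in Set.Ioc (0 : ℝ) 1, 2 * ε = 2 * ε := by simp
  rw [setIntegral_Iic_exp_eq_setIntegral_Ioc μ hc, setIntegral_Iic_exp_eq_setIntegral_Ioc ν hc]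
  rw [← hconst, ← integral_add (hint ν) (integrable_const _)]
  refine integral_mono (hint μ) ((hint ν).add (integrable_const _)) fun t => ?_
  have h₁ := (abs_le.1 (h b)).2
  have h₂ := (abs_le.1 (h (b + Real.log t / c))).1
  dsimp only
  linarith

theorem gaussianPDFReal_zero_one (x : ℝ) :
    gaussianPDFReal 0 1 x = Real.exp (-x ^ 2 / 2) / Real.sqrt (2 * Real.pi) := by
  simp [gaussianPDFReal_def, div_eq_inv_mul]

theorem gaussianReal_real_Iic_eq_Phi (y : ℝ) : (gaussianReal 0 1).real (Set.Iic y) = Phi y := by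
  rw [measureReal_def, gaussianReal_apply_eq_integral 0 one_ne_zero, ENNReal.toReal_ofReal
    (integral_nonneg fun x => gaussianPDFReal_nonneg 0 1 x), Phi]
  simp only [gaussianPDFReal_zero_one]

theorem setIntegral_gaussianReal_zero_one (f : ℝ → ℝ) {s : Set ℝ} (hs : MeasurableSet s) :
    ∫ x in s, f x ∂gaussianReal 0 1
      = ∫ x in s, f x * (Real.exp (-x ^ 2 / 2) / Real.sqrt (2 * Real.pi)) := by
  rw [gaussianReal_of_var_ne_zero 0 one_ne_zero,
    setIntegral_withDensity_eq_setIntegral_toReal_smul (measurable_gaussianPDF 0 1)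
      (ae_of_all _ fun _ => gaussianPDF_lt_top) f hs]
  simp only [toReal_gaussianPDF, gaussianPDFReal_zero_one, smul_eq_mul, mul_comm]

/-- If the cdf `H` of a real random variable `W` satisfies `|H y − Φ y| ≤ ε` for all `y`,
then for every `c > 0` and every `b`,
`E[e^{c(W−b)} 1{W ≤ b}] ≤ ∫_{−∞}^{b} e^{c(y−b)} φ(y) dy + 2ε`, where `φ` is the standard
normal density. -/
theorem tilted_truncated_expectation_bound
    {Ω : Type*} [MeasurableSpace Ω] (P : Measure Ω) [IsProbabilityMeasure P]
    (W : Ω → ℝ) (hW : Measurable W)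
    (ε : ℝ) (hε : 0 ≤ ε)
    (hH : ∀ y : ℝ, |(P {ω | W ω ≤ y}).toReal - Phi y| ≤ ε)
    (c : ℝ) (hc : 0 < c) (b : ℝ) :
    ∫ ω in {ω | W ω ≤ b}, Real.exp (c * (W ω - b)) ∂P
      ≤ (∫ y in Set.Iic b,
          Real.exp (c * (y - b)) * (Real.exp (-y ^ 2 / 2) / Real.sqrt (2 * Real.pi)))
        + 2 * ε := by
  have hprob : IsProbabilityMeasure (P.map W) := Measure.isProbabilityMeasure_map hW.aemeasurable
  have hclose (y : ℝ) :
      |(P.map W).real (Set.Iic y) - (gaussianReal 0 1).real (Set.Iic y)| ≤ ε := by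
    rw [gaussianReal_real_Iic_eq_Phi, map_measureReal_apply hW measurableSet_Iic]
    exact hH y
  have hmain := setIntegral_Iic_exp_le_add (P.map W) (gaussianReal 0 1) hclose hc b
  rwa [setIntegral_gaussianReal_zero_one _ measurableSet_Iic,
    setIntegral_map measurableSet_Iic (by fun_prop) hW.aemeasurable] at hmain
end

section
/- Let Z be a Gaussian random variable with mean μ > 0 and variance σ² > 0, set γ = μ²/(2σ²), and for θ ∈ ℝ set λ = √(2γ) + σθ. Then the moment generating function of min(Z, 0) satisfies E[e^{θ·min(Z,0)}] = Φ(−λ)·e^{−γ}·e^{λ²/2} + Φ(√(2γ)). -/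
open MeasureTheory ProbabilityTheory Real

lemma Phi_eq_setIntegral_gaussianPDFReal (x : ℝ) :
    Phi x = ∫ t in Set.Iic x, gaussianPDFReal 0 1 t := by
  refine setIntegral_congr_fun measurableSet_Iic fun t _ ↦ ?_
  simp [gaussianPDFReal, div_eq_inv_mul]

lemma setIntegral_Ioi_gaussianPDFReal (x : ℝ) :
    ∫ t in Set.Ioi (-x), gaussianPDFReal 0 1 t = Phi x := by
  rw [Phi_eq_setIntegral_gaussianPDFReal, ← integral_comp_neg_Iic]
  simp [gaussianPDFReal]

lemma setIntegral_Iic_gaussianPDFReal_sub (x c : ℝ) :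
    ∫ t in Set.Iic x, gaussianPDFReal 0 1 (t - c) = Phi (x - c) := by
  rw [Phi_eq_setIntegral_gaussianPDFReal]
  simpa using (measurePreserving_sub_right volume c).setIntegral_preimage_emb
    (measurableEmbedding_subRight c) (gaussianPDFReal 0 1) (Set.Iic (x - c))

lemma gaussianPDFReal_mul_exp (a b t : ℝ) :
    gaussianPDFReal 0 1 t * Real.exp (a + b * t)
      = Real.exp (a + b ^ 2 / 2) * gaussianPDFReal 0 1 (t - b) := by
  simp only [gaussianPDFReal, NNReal.coe_one]
  rw [mul_assoc, mul_left_comm (Real.exp (a + _)), ← Real.exp_add, ← Real.exp_add]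
  ring_nf

lemma gaussianReal_eq_map_standard (μ σ : ℝ) :
    gaussianReal μ ⟨σ ^ 2, sq_nonneg σ⟩ = (gaussianReal 0 1).map (fun x ↦ μ + σ * x) := by
  have h : (fun x : ℝ ↦ μ + σ * x) = (fun x ↦ μ + x) ∘ (fun x ↦ σ * x) := rfl
  rw [h, ← Measure.map_map (by fun_prop) (by fun_prop), gaussianReal_map_const_mul,
    gaussianReal_map_const_add]
  simp
  rfl

/-- If `Z` is Gaussian with mean `μ > 0` and variance `σ² > 0`, `γ = μ² / (2σ²)`, and
`lam = √(2γ) + σθ`, then the moment generating function of `min (Z, 0)` satisfies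
`E[e^{θ min(Z,0)}] = Φ(−lam) e^{−γ} e^{lam²/2} + Φ(√(2γ))`. -/
theorem truncated_gaussian_mgf
    {Ω : Type*} [MeasurableSpace Ω] (P : Measure Ω) [IsProbabilityMeasure P]
    (μ σ : ℝ) (hμ : 0 < μ) (hσ : 0 < σ)
    (Z : Ω → ℝ) (hZ : Measurable Z)
    (hlaw : P.map Z = gaussianReal μ ⟨σ ^ 2, sq_nonneg σ⟩)
    (γ : ℝ) (hγ : γ = μ ^ 2 / (2 * σ ^ 2))
    (θ lam : ℝ) (hlam : lam = Real.sqrt (2 * γ) + σ * θ) :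
    ∫ ω, Real.exp (θ * min (Z ω) 0) ∂P
      = Phi (-lam) * Real.exp (-γ) * Real.exp (lam ^ 2 / 2)
        + Phi (Real.sqrt (2 * γ)) := by
  have hsqrt : Real.sqrt (2 * γ) = μ / σ := by
    rw [show 2 * γ = (μ / σ) ^ 2 by rw [hγ]; field_simp, Real.sqrt_sq (by positivity)]
  rw [hsqrt] at hlam ⊢
  have hstd : ∫ ω, Real.exp (θ * min (Z ω) 0) ∂P
      = ∫ x, gaussianPDFReal 0 1 x * Real.exp (θ * min (μ + σ * x) 0) := by
    rw [← integral_map (f := fun z ↦ Real.exp (θ * min z 0)) hZ.aemeasurable (by fun_prop), hlaw,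
      gaussianReal_eq_map_standard, integral_map (by fun_prop) (by fun_prop),
      integral_gaussianReal_eq_integral_smul one_ne_zero]
    simp only [smul_eq_mul]
  have hIic : Set.EqOn (fun x ↦ gaussianPDFReal 0 1 x * Real.exp (θ * min (μ + σ * x) 0))
      (fun x ↦ Real.exp (θ * μ + (σ * θ) ^ 2 / 2) * gaussianPDFReal 0 1 (x - σ * θ))
      (Set.Iic (-(μ / σ))) := by
    intro x hx
    have hx' : μ + σ * x ≤ 0 := by
      have := mul_le_mul_of_nonneg_left (Set.mem_Iic.1 hx) hσ.le
      rw [mul_neg, mul_div_cancel₀ _ hσ.ne'] at this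
      linarith
    dsimp only
    rw [min_eq_left hx', ← gaussianPDFReal_mul_exp]
    ring_nf
  have hIoi : Set.EqOn (fun x ↦ gaussianPDFReal 0 1 x * Real.exp (θ * min (μ + σ * x) 0))
      (gaussianPDFReal 0 1) (Set.Ioi (-(μ / σ))) := by
    intro x hx
    have hx' : 0 ≤ μ + σ * x := by
      have := mul_le_mul_of_nonneg_left (Set.mem_Ioi.1 hx).le hσ.le
      rw [mul_neg, mul_div_cancel₀ _ hσ.ne'] at this
      linarith
    simp [min_eq_right hx']
  have hintIic := (((integrable_gaussianPDFReal 0 1).comp_sub_right (σ * θ)).const_mul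
    (Real.exp (θ * μ + (σ * θ) ^ 2 / 2))).integrableOn.congr_fun hIic.symm measurableSet_Iic
  have hintIoi := (integrable_gaussianPDFReal 0 1).integrableOn.congr_fun hIoi.symm
    measurableSet_Ioi
  rw [hstd, ← intervalIntegral.integral_Iic_add_Ioi hintIic hintIoi,
    setIntegral_congr_fun measurableSet_Iic hIic, setIntegral_congr_fun measurableSet_Ioi hIoi,
    integral_const_mul, setIntegral_Iic_gaussianPDFReal_sub, setIntegral_Ioi_gaussianPDFReal,
    mul_assoc, ← Real.exp_add, mul_comm]
  congr 3
  · rw [hlam]; ring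
  · rw [hlam, hγ]; field_simp; ring
end

section
/- Let γ > 0 and let ρ ∈ [0, 1) satisfy ρ > 1 − √(4πγ)e^{γ}/(1 + √(4πγ)e^{γ}Φ(√(2γ))). Then there exists a unique λ ∈ (0, √(2γ)) satisfying λ·e^{λ²/2}·Φ(−λ) = (1/√(2π))·(1 − ρ) − ρ·e^{γ}·Φ(√(2γ))·λ. -/
open MeasureTheory Real

lemma integrable_stdNormalDensity :
    Integrable fun t : ℝ => Real.exp (-t ^ 2 / 2) / Real.sqrt (2 * Real.pi) := by
  have h := (integrable_exp_neg_mul_sq (b := 1 / 2) (by norm_num)).div_const (√(2 * π))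
  refine h.congr (Filter.Eventually.of_forall fun t => ?_)
  dsimp only
  ring_nf

lemma Phi_nonneg (x : ℝ) : 0 ≤ Phi x :=
  integral_nonneg fun _ => by positivity

lemma continuous_Phi : Continuous Phi := by
  have h : Phi = fun x => Phi 0 +
      ∫ t in (0 : ℝ)..x, Real.exp (-t ^ 2 / 2) / Real.sqrt (2 * Real.pi) := by
    funext x
    rw [← intervalIntegral.integral_Iic_sub_Iic integrable_stdNormalDensity.integrableOn
      integrable_stdNormalDensity.integrableOn]
    simp [Phi]
  rw [h]
  exact continuous_const.add (intervalIntegral.continuous_primitive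
    (fun _ _ => integrable_stdNormalDensity.intervalIntegrable) 0)

lemma Phi_neg_eq_integral_Ioi (x : ℝ) :
    Phi (-x) = ∫ t in Set.Ioi x, Real.exp (-t ^ 2 / 2) / Real.sqrt (2 * Real.pi) := by
  have h := integral_comp_neg_Iic (-x)
    fun t : ℝ => Real.exp (-t ^ 2 / 2) / Real.sqrt (2 * Real.pi)
  simpa only [Phi, neg_sq, neg_neg] using h

lemma Phi_neg_add_Phi (x : ℝ) : Phi (-x) + Phi x = 1 := by
  rw [Phi_neg_eq_integral_Ioi, add_comm, Phi,
    intervalIntegral.integral_Iic_add_Ioi integrable_stdNormalDensity.integrableOn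
      integrable_stdNormalDensity.integrableOn, integral_div]
  have h := integral_gaussian (1 / 2)
  have e : π / (1 / 2) = 2 * π := by ring
  rw [e] at h
  rw [← h, ← integral_div]
  have e' : ∀ t : ℝ, -t ^ 2 / 2 = -(1 / 2) * t ^ 2 := fun t => by ring
  simp only [e', integral_div]
  rw [h]
  exact div_self (by positivity)

lemma mul_exp_mul_Phi_neg_eq_integral {x : ℝ} (hx : 0 < x) :
    x * Real.exp (x ^ 2 / 2) * Phi (-x) =
      ∫ u in Set.Ioi (0 : ℝ), Real.exp (-u - u ^ 2 / (2 * x ^ 2)) / Real.sqrt (2 * Real.pi) := by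
  have translate := (measurePreserving_add_left volume x).setIntegral_preimage_emb
    (measurableEmbedding_addLeft x)
    (fun t : ℝ => Real.exp (-t ^ 2 / 2) / Real.sqrt (2 * Real.pi)) (Set.Ioi x)
  have scale := integral_comp_mul_left_Ioi
    (fun t : ℝ => Real.exp (-(x + t) ^ 2 / 2) / Real.sqrt (2 * Real.pi)) 0 (inv_pos.2 hx)
  simp only [Set.preimage_const_add_Ioi, sub_self] at translate
  rw [mul_zero, translate, ← Phi_neg_eq_integral_Ioi, inv_inv, smul_eq_mul] at scale
  rw [mul_right_comm, ← scale, ← integral_mul_const]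
  congr 1 with u
  rw [div_mul_eq_mul_div, ← Real.exp_add]
  congr 2
  field_simp
  ring

lemma strictMonoOn_mul_exp_mul_Phi_neg :
    StrictMonoOn (fun x : ℝ => x * Real.exp (x ^ 2 / 2) * Phi (-x)) (Set.Ioi 0) := by
  have integrable (x : ℝ) : IntegrableOn
      (fun u : ℝ => Real.exp (-u - u ^ 2 / (2 * x ^ 2)) / Real.sqrt (2 * Real.pi))
      (Set.Ioi 0) := by
    refine Integrable.div_const ?_ _
    refine (integrableOn_exp_neg_Ioi 0).mono' (by fun_prop) (Filter.Eventually.of_forall fun u => ?_)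
    rw [Real.norm_of_nonneg (by positivity)]
    gcongr
    have : 0 ≤ u ^ 2 / (2 * x ^ 2) := by positivity
    linarith
  intro a ha b hb hab
  simp only [Set.mem_Ioi] at ha hb
  dsimp only
  rw [mul_exp_mul_Phi_neg_eq_integral ha, mul_exp_mul_Phi_neg_eq_integral hb, ← sub_pos,
    ← integral_sub (integrable b) (integrable a)]
  have pos (u : ℝ) (hu : u ∈ Set.Ioi (0 : ℝ)) :
      0 < Real.exp (-u - u ^ 2 / (2 * b ^ 2)) / Real.sqrt (2 * Real.pi) -
        Real.exp (-u - u ^ 2 / (2 * a ^ 2)) / Real.sqrt (2 * Real.pi) := by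
    have hu' : 0 < u := hu
    rw [sub_pos]
    gcongr
  rw [setIntegral_pos_iff_support_of_nonneg_ae
    (ae_restrict_of_forall_mem measurableSet_Ioi fun u hu => (pos u hu).le)
    ((integrable b).sub (integrable a)),
    Set.inter_eq_self_of_subset_right fun u hu => Function.mem_support.2 (pos u hu).ne', Real.volume_Ioi]
  exact ENNReal.zero_lt_top

/-- For `γ > 0` and `ρ ∈ [0, 1)` with
`ρ > 1 − √(4πγ)e^γ / (1 + √(4πγ)e^γ Φ(√(2γ)))`, there is a unique
`lam ∈ (0, √(2γ))` with
`lam·e^{lam²/2}·Φ(−lam) = (1/√(2π))(1 − ρ) − ρ e^γ Φ(√(2γ)) lam`. -/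
theorem unique_twisting_parameter
    (γ ρ : ℝ) (hγ : 0 < γ) (hρ0 : 0 ≤ ρ) (hρ1 : ρ < 1)
    (hρ : 1 - Real.sqrt (4 * Real.pi * γ) * Real.exp γ
          / (1 + Real.sqrt (4 * Real.pi * γ) * Real.exp γ * Phi (Real.sqrt (2 * γ)))
        < ρ) :
    ∃! lam : ℝ, lam ∈ Set.Ioo 0 (Real.sqrt (2 * γ)) ∧
      lam * Real.exp (lam ^ 2 / 2) * Phi (-lam)
        = (1 / Real.sqrt (2 * Real.pi)) * (1 - ρ)
          - ρ * Real.exp γ * Phi (Real.sqrt (2 * γ)) * lam := by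
  set L := √(2 * γ) with hL
  have hLpos : 0 < L := by positivity
  have hexp : L ^ 2 / 2 = γ := by rw [hL, Real.sq_sqrt (by positivity)]; ring
  set c := √(2 * π) with hc
  have hcpos : 0 < c := by positivity
  have hcL : √(4 * π * γ) = c * L := by
    rw [hc, hL, ← Real.sqrt_mul (by positivity)]
    ring_nf
  rw [hcL] at hρ
  have hPhi := Phi_nonneg L
  have slope_nonneg : 0 ≤ ρ * Real.exp γ * Phi L := by positivity
  set F : ℝ → ℝ := fun x =>
    x * Real.exp (x ^ 2 / 2) * Phi (-x) + ρ * Real.exp γ * Phi L * x with hF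
  have F_mono : StrictMonoOn F (Set.Ioi 0) :=
    strictMonoOn_mul_exp_mul_Phi_neg.add_monotone fun x _ y _ hxy =>
      mul_le_mul_of_nonneg_left hxy slope_nonneg
  have F_cont : Continuous F := by
    have := continuous_Phi
    fun_prop
  have F_zero : F 0 < 1 / c * (1 - ρ) := by
    have : 0 < 1 / c * (1 - ρ) := mul_pos (by positivity) (by linarith)
    simpa [hF] using this
  have F_right : 1 / c * (1 - ρ) < F L := by
    have h : 1 - ρ < c * L * Real.exp γ / (1 + c * L * Real.exp γ * Phi L) := by linarith
    rw [lt_div_iff₀ (by positivity)] at h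
    simp only [hF, hexp]
    rw [one_div_mul_eq_div, div_lt_iff₀ hcpos, eq_sub_of_add_eq (Phi_neg_add_Phi L)]
    linarith
  obtain ⟨x, hx, hFx⟩ := intermediate_value_Ioo hLpos.le F_cont.continuousOn ⟨F_zero, F_right⟩
  refine ⟨x, ⟨hx, eq_sub_of_add_eq hFx⟩, fun y hy => ?_⟩
  exact F_mono.injOn hy.1.1 hx.1 ((add_eq_of_eq_sub hy.2).trans hFx.symm)
end

section
/- Let N ≥ 1 and 0 ≤ ℓ ≤ N be integers, let φ = (φ_0, ..., φ_{N−1}) ∈ ℝ^N, define y_j = 1 if φ_j < 0 and y_j = 0 otherwise, let x = (x_0, ..., x_{ℓ−1}) ∈ {0,1}^ℓ, and let J = {j : 0 ≤ j ≤ ℓ−1, x_j = 1}. Then Σ_{j=0}^{ℓ−1} (y_j ⊕ x_j)·|φ_j| ≤ Σ_{j=0}^{N−1} (y_j ⊕ 0)·|φ_j| holds if and only if Σ_{j∈J} φ_j + Σ_{j=ℓ}^{N−1} min(φ_j, 0) ≤ 0. -/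
/-- Flipping a hypothesis bit from `0` to `1` changes the hard-decision metric by `a`. -/
lemma xor_hardDecision_mul_abs (a : ℝ) {b : ℕ} (hb : b = 0 ∨ b = 1) :
    ((((if a < 0 then 1 else 0) + b) % 2 : ℕ) : ℝ) * |a|
      = ((((if a < 0 then 1 else 0) + 0) % 2 : ℕ) : ℝ) * |a| + if b = 1 then a else 0 := by
  rcases hb with rfl | rfl <;> split_ifs with h <;>
    simp_all [abs_of_neg, abs_of_nonneg]

lemma hardDecision_mul_abs (a : ℝ) :
    ((((if a < 0 then 1 else 0) + 0) % 2 : ℕ) : ℝ) * |a| = -min a 0 := by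
  split_ifs with h
  · simp [abs_of_neg h, min_eq_left h.le]
  · simp [min_eq_right (not_lt.mp h)]


/-- **MLSDA path-metric inequality.**  For `φ ∈ ℝᴺ`, hard decisions
`y j = 1` iff `φ j < 0`, a binary word `x ∈ {0,1}^ℓ` (`0 ≤ ℓ ≤ N`), and
`J = {j < ℓ | x j = 1}`, the inequality
`∑_{j<ℓ} (y j ⊕ x j)·|φ j| ≤ ∑_{j<N} (y j ⊕ 0)·|φ j|`
holds iff `∑_{j∈J} φ j + ∑_{ℓ≤j<N} min (φ j) 0 ≤ 0`. -/
theorem mlsda_metric_iff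
    (N ℓ : ℕ) (hN : 1 ≤ N) (hℓ : ℓ ≤ N)
    (φ : ℕ → ℝ) (x : ℕ → ℕ) (hx : ∀ j < ℓ, x j = 0 ∨ x j = 1)
    (y : ℕ → ℕ) (hy : ∀ j, y j = if φ j < 0 then 1 else 0) :
    (∑ j ∈ Finset.range ℓ, (((y j + x j) % 2 : ℕ) : ℝ) * |φ j|
      ≤ ∑ j ∈ Finset.range N, (((y j + 0) % 2 : ℕ) : ℝ) * |φ j|)
    ↔ ∑ j ∈ (Finset.range ℓ).filter (fun j => x j = 1), φ j
        + ∑ j ∈ Finset.Ico ℓ N, min (φ j) 0 ≤ 0 := by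
  obtain rfl : y = fun j => if φ j < 0 then 1 else 0 := funext hy
  have head := Finset.sum_congr (rfl : Finset.range ℓ = Finset.range ℓ) fun j hj =>
    xor_hardDecision_mul_abs (φ j) (hx j (Finset.mem_range.mp hj))
  have tail := Finset.sum_congr (rfl : Finset.Ico ℓ N = Finset.Ico ℓ N) fun j _ =>
    hardDecision_mul_abs (φ j)
  rw [Finset.sum_add_distrib, ← Finset.sum_filter] at head
  rw [Finset.sum_neg_distrib] at tail
  rw [head, ← Finset.sum_range_add_sum_Ico _ hℓ, tail]
  constructor <;> intro h <;> linarith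
end
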